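/- Let K be an algebraically closed field, A a finite dimensional K-algebra, V a finite dimensional K-vector space, and M ∈ mod A. Then, in the set of A-module structures on V (the K-algebra homomorphisms ρ : A → End_K(V), a Zariski-closed subset of the affine space Hom_K(A, End_K(V))), both subsets {ρ : Hom_A(V_ρ, M) = 0} and {ρ : Hom_A(M, V_ρ) = 0} are open in the Zariski topology. -/

import Mathlib

namespace TorsPaper

variable (A : Type) [Ring A]

/-- `N` is (isomorphic to) a factor module of `M`. -/
def IsQuotientOf (N M : ModuleCat.{0} A) : Prop :=
  ∃ f : M →ₗ[A] N, Function.Surjective f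

/-- `L` is (isomorphic to) a submodule of `M`. -/
def IsSubmoduleOf (L M : ModuleCat.{0} A) : Prop :=
  ∃ f : L →ₗ[A] M, Function.Injective f

/-- `M` is a nonzero module. -/
def Nonzero (M : ModuleCat.{0} A) : Prop := ∃ x : M, x ≠ 0

/-- A torsion class in `mod A`: a class of finitely generated modules, containing the zero
modules, closed under isomorphisms (which follows from `quot`), factor modules and
extensions. -/
structure IsTorsionClass (T : ModuleCat.{0} A → Prop) : Prop where
  fin : ∀ M, T M → Module.Finite A M
  zero : ∀ M : ModuleCat.{0} A, (∀ x : M, x = 0) → T M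
  quot : ∀ M N : ModuleCat.{0} A, T M → Module.Finite A N → IsQuotientOf A N M → T N
  ext : ∀ M : ModuleCat.{0} A, Module.Finite A M → ∀ N : Submodule A M,
    T (ModuleCat.of A N) → T (ModuleCat.of A (M ⧸ N)) → T M

/-- A torsion-free class in `mod A`. -/
structure IsTorsionFreeClass (F : ModuleCat.{0} A → Prop) : Prop where
  fin : ∀ M, F M → Module.Finite A M
  zero : ∀ M : ModuleCat.{0} A, (∀ x : M, x = 0) → F M
  sub : ∀ M N : ModuleCat.{0} A, F M → Module.Finite A N → IsSubmoduleOf A N M → F N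
  ext : ∀ M : ModuleCat.{0} A, Module.Finite A M → ∀ N : Submodule A M,
    F (ModuleCat.of A N) → F (ModuleCat.of A (M ⧸ N)) → F M

/-- The right Hom-perpendicular class `T^⊥` inside `mod A`. -/
def rightPerp (T : ModuleCat.{0} A → Prop) : ModuleCat.{0} A → Prop :=
  fun X => Module.Finite A X ∧ ∀ M : ModuleCat.{0} A, T M → ∀ f : M →ₗ[A] X, f = 0

/-- The smallest torsion class containing a class `S` of modules. -/
def torsClosure (S : ModuleCat.{0} A → Prop) : ModuleCat.{0} A → Prop :=
  fun X => ∀ T : ModuleCat.{0} A → Prop, IsTorsionClass A T → (∀ Y, S Y → T Y) → T X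

/-- The smallest torsion-free class containing a class `S` of modules. -/
def torfClosure (S : ModuleCat.{0} A → Prop) : ModuleCat.{0} A → Prop :=
  fun X => ∀ F : ModuleCat.{0} A → Prop, IsTorsionFreeClass A F → (∀ Y, S Y → F Y) → F X

/-- A torsion class is compact if it is the smallest torsion class containing a single
module `M`. -/
def IsCompactTors (T : ModuleCat.{0} A → Prop) : Prop :=
  ∃ M : ModuleCat.{0} A, Module.Finite A M ∧ T = torsClosure A (fun X => X = M)

/-- A torsion class is cocompact if `T^⊥` is the smallest torsion-free class containing a
single module `N`. -/
def IsCocompactTors (T : ModuleCat.{0} A → Prop) : Prop :=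
  ∃ N : ModuleCat.{0} A, Module.Finite A N ∧ rightPerp A T = torfClosure A (fun X => X = N)

/-- A torsion class is bicompact if it is both compact and cocompact. -/
def IsBicompactTors (T : ModuleCat.{0} A → Prop) : Prop :=
  IsCompactTors A T ∧ IsCocompactTors A T

/-- A class `C` of modules is functorially finite in `mod A` if every finitely generated
module has a left `C`-approximation and a right `C`-approximation. -/
def FunctoriallyFinite (C : ModuleCat.{0} A → Prop) : Prop :=
  (∀ M : ModuleCat.{0} A, Module.Finite A M →
    ∃ (X : ModuleCat.{0} A) (f : M →ₗ[A] X), C X ∧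
      ∀ Y : ModuleCat.{0} A, C Y → ∀ g : M →ₗ[A] Y, ∃ h : X →ₗ[A] Y, h.comp f = g) ∧
  (∀ M : ModuleCat.{0} A, Module.Finite A M →
    ∃ (X : ModuleCat.{0} A) (f : X →ₗ[A] M), C X ∧
      ∀ Y : ModuleCat.{0} A, C Y → ∀ g : Y →ₗ[A] M, ∃ h : Y →ₗ[A] X, f.comp h = g)

/-- A stability function: a real-valued function on `mod A` which is additive on short
exact sequences. -/
def IsStability (θ : ModuleCat.{0} A → ℝ) : Prop :=
  ∀ L M N : ModuleCat.{0} A, Module.Finite A L → Module.Finite A M → Module.Finite A N →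
    ∀ (f : L →ₗ[A] M) (g : M →ₗ[A] N), Function.Injective f → Function.Surjective g →
      LinearMap.range f = LinearMap.ker g → θ M = θ L + θ N

/-- The semistable torsion class `T_θ`. -/
def tTheta (θ : ModuleCat.{0} A → ℝ) : ModuleCat.{0} A → Prop :=
  fun M => Module.Finite A M ∧ ∀ N : ModuleCat.{0} A, Module.Finite A N →
    IsQuotientOf A N M → Nonzero A N → 0 < θ N

/-- The semistable torsion class `\bar T_θ`. -/
def tThetaBar (θ : ModuleCat.{0} A → ℝ) : ModuleCat.{0} A → Prop :=
  fun M => Module.Finite A M ∧ ∀ N : ModuleCat.{0} A, Module.Finite A N →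
    IsQuotientOf A N M → 0 ≤ θ N

/-- The semistable torsion-free class `F_θ`. -/
def fTheta (θ : ModuleCat.{0} A → ℝ) : ModuleCat.{0} A → Prop :=
  fun M => Module.Finite A M ∧ ∀ L : ModuleCat.{0} A, Module.Finite A L →
    IsSubmoduleOf A L M → Nonzero A L → θ L < 0

/-- The semistable torsion-free class `\bar F_θ`. -/
def fThetaBar (θ : ModuleCat.{0} A → ℝ) : ModuleCat.{0} A → Prop :=
  fun M => Module.Finite A M ∧ ∀ L : ModuleCat.{0} A, Module.Finite A L →
    IsSubmoduleOf A L M → θ L ≤ 0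

/-- An integer-valued function on `mod A` additive on short exact sequences; these are
exactly the group homomorphisms `K0(mod A) → ℤ`. -/
def IsAdditiveZ (φ : ModuleCat.{0} A → ℤ) : Prop :=
  ∀ L M N : ModuleCat.{0} A, Module.Finite A L → Module.Finite A M → Module.Finite A N →
    ∀ (f : L →ₗ[A] M) (g : M →ₗ[A] N), Function.Injective f → Function.Surjective g →
      LinearMap.range f = LinearMap.ker g → φ M = φ L + φ N

/-- `[X] = [Y]` in the Grothendieck group `K0(mod A)`: since `K0(mod A)` is free abelian
on the simple modules, this holds iff all additive `ℤ`-valued functions agree on `X`, `Y`. -/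
def SameK0Class (X Y : ModuleCat.{0} A) : Prop :=
  ∀ φ : ModuleCat.{0} A → ℤ, IsAdditiveZ A φ → φ X = φ Y

/-- Two classes of modules are numerically disjoint if they contain no nonzero `X`, `Y`
with `[X] = [Y] ≠ 0` in `K0(mod A)`. -/
def NumericallyDisjoint (C D : ModuleCat.{0} A → Prop) : Prop :=
  ¬ ∃ X Y : ModuleCat.{0} A, C X ∧ D Y ∧ Nonzero A X ∧ Nonzero A Y ∧ SameK0Class A X Y

/-- A brick: a finitely generated module whose endomorphism algebra is a division algebra,
i.e. `M` is nonzero and every nonzero endomorphism is invertible. -/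
def IsBrick (M : ModuleCat.{0} A) : Prop :=
  Module.Finite A M ∧ Nonzero A M ∧ ∀ f : M →ₗ[A] M, f ≠ 0 → Function.Bijective f

/-- A semibrick: a set of pairwise Hom-orthogonal bricks. -/
def IsSemibrick (S : Set (ModuleCat.{0} A)) : Prop :=
  (∀ M ∈ S, IsBrick A M) ∧
    ∀ M ∈ S, ∀ N ∈ S, M ≠ N → ∀ f : M →ₗ[A] N, f = 0

end TorsPaper

namespace TorsPaper


variable (K : Type) [Field K]

/-- The polynomial functions on a `K`-vector space `W`: the `K`-subalgebra of `W → K`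
generated by the linear forms. -/
def polyFuns (W : Type) [AddCommGroup W] [Module K W] : Subalgebra K (W → K) :=
  Algebra.adjoin K (Set.range fun l : W →ₗ[K] K => (l : W → K))

/-- The Zariski topology on a `K`-vector space `W`: closed sets are the common zero loci
of sets of polynomial functions. -/
def zariskiTop (W : Type) [AddCommGroup W] [Module K W] : TopologicalSpace W :=
  TopologicalSpace.generateFrom { U | ∃ f ∈ polyFuns K W, U = {x | f x ≠ 0} }

variable (A : Type) [Ring A] [Algebra K A]
variable (V : Type) [AddCommGroup V] [Module K V]

/-- The set of `A`-module structures on the `K`-vector space `V`, i.e. the `K`-algebra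
homomorphisms `A → End_K(V)`, as a subset of the affine space `Hom_K(A, End_K(V))`. -/
def RepSpace : Type :=
  { ρ : A →ₗ[K] (V →ₗ[K] V) // ρ 1 = LinearMap.id ∧
      ∀ a b : A, ρ (a * b) = (ρ a).comp (ρ b) }

/-- The (subspace) Zariski topology on the set of `A`-module structures on `V`. -/
def repTop : TopologicalSpace (RepSpace K A V) :=
  TopologicalSpace.induced Subtype.val (zariskiTop K (A →ₗ[K] (V →ₗ[K] V)))


/-- Injectivity is an open condition on a family of linear maps depending affinely
on the parameter. -/
theorem isOpen_injective_family (K : Type) [Field K] (W E F : Type) [AddCommGroup W] [Module K W]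
    [AddCommGroup E] [Module K E] [AddCommGroup F] [Module K F] [FiniteDimensional K E]
    (T : W → E →ₗ[K] F) (L : E → W →ₗ[K] F) (c : E → F)
    (hT : ∀ w e, T w e = L e w + c e) :
    @IsOpen _ (zariskiTop K W) {w | Function.Injective (T w)} := by
  letI := zariskiTop K W
  rw [isOpen_iff_forall_mem_open]
  intro w₀ hw₀
  obtain ⟨S, hS⟩ := LinearMap.exists_leftInverse_of_injective (T w₀)
    (LinearMap.ker_eq_bot.mpr hw₀)
  let b := Module.finBasis K E
  refine ⟨{w | LinearMap.det (S ∘ₗ T w) ≠ 0}, ?_, ?_, ?_⟩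
  · intro w hw
    have h1 : Function.Injective (S ∘ₗ T w) := by
      have := (LinearMap.equivOfDetNeZero _ hw).injective
      exact this
    exact Function.Injective.of_comp (f := S) (by simpa using h1)
  · apply TopologicalSpace.isOpen_generateFrom_of_mem
    refine ⟨fun w => LinearMap.det (S ∘ₗ T w), ?_, rfl⟩
    have key : (fun w => LinearMap.det (S ∘ₗ T w)) =
        ∑ σ : Equiv.Perm (Fin (Module.finrank K E)), (Equiv.Perm.sign σ : ℤ) •
          ∏ i, (fun w => b.repr (S (T w (b i))) (σ i)) := by
      funext w
      rw [← LinearMap.det_toMatrix b, Matrix.det_apply]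
      simp [LinearMap.toMatrix_apply, Units.smul_def]
    rw [key]
    refine Subalgebra.sum_mem _ fun σ _ => Subalgebra.zsmul_mem _ (Subalgebra.prod_mem _ fun i _ => ?_) _
    have h2 : (fun w => b.repr (S (T w (b i))) (σ i)) =
        ((b.coord (σ i) ∘ₗ S ∘ₗ L (b i) : W →ₗ[K] K) : W → K) +
          algebraMap K (W → K) (b.repr (S (c (b i))) (σ i)) := by
      funext w
      simp [hT]
    rw [h2]
    exact Subalgebra.add_mem _ (Algebra.subset_adjoin ⟨_, rfl⟩) (Subalgebra.algebraMap_mem _ _)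
  · simp [hS]

/-- In the space of `A`-module structures on a finite dimensional
vector space `V` (with its Zariski topology), the loci `{ρ : Hom_A(V_ρ, M) = 0}` and
`{ρ : Hom_A(M, V_ρ) = 0}` are open, for any `M ∈ mod A`. -/
theorem stmt11 [IsAlgClosed K] [FiniteDimensional K A] [FiniteDimensional K V]
    (M : ModuleCat.{0} A) (hM : Module.Finite A M) :
    @IsOpen _ (repTop K A V)
      {ρ : RepSpace K A V |
        ∀ f : V →+ M, (∀ (a : A) (v : V), f (ρ.1 a v) = a • f v) → f = 0} ∧
    @IsOpen _ (repTop K A V)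
      {ρ : RepSpace K A V |
        ∀ f : M →+ V, (∀ (a : A) (x : M), f (a • x) = ρ.1 a (f x)) → f = 0} := by
  letI : Module K M := Module.compHom M (algebraMap K A)
  have hsm : ∀ (k : K) (x : M), k • x = algebraMap K A k • x := fun k x => rfl
  haveI : IsScalarTower K A M := ⟨fun k a x => by
    rw [hsm, Algebra.smul_def, mul_smul]⟩
  have hcomm : ∀ (k : K) (a : A) (x : M), a • k • x = k • a • x := fun k a x => by
    rw [hsm, hsm, ← mul_smul, ← mul_smul, Algebra.commutes]
  haveI : FiniteDimensional K M := Module.Finite.trans A M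
  have hρ : ∀ (ρ : RepSpace K A V) (k : K) (v : V), ρ.1 (algebraMap K A k) v = k • v := by
    intro ρ k v
    rw [Algebra.algebraMap_eq_smul_one, map_smul, ρ.2.1]
    rfl
  letI := zariskiTop K (A →ₗ[K] (V →ₗ[K] V))
  constructor
  · let T : (A →ₗ[K] (V →ₗ[K] V)) → (V →ₗ[K] M) →ₗ[K] (A → V → M) := fun w =>
      { toFun := fun f a v => f (w a v) - a • f v
        map_add' := fun f g => by
          funext a v; simp only [LinearMap.add_apply, Pi.add_apply, smul_add]; abel
        map_smul' := fun k f => by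
          funext a v
          simp only [LinearMap.smul_apply, Pi.smul_apply, RingHom.id_apply, smul_sub, hcomm] }
    let L : (V →ₗ[K] M) → (A →ₗ[K] (V →ₗ[K] V)) →ₗ[K] (A → V → M) := fun f =>
      { toFun := fun w a v => f (w a v)
        map_add' := fun w w' => by funext a v; simp
        map_smul' := fun k w => by funext a v; simp }
    have h := isOpen_injective_family K _ _ _ T L (fun f a v => - (a • f v))
      (fun w f => by funext a v; simp [T, L, sub_eq_add_neg])
    refine ⟨_, h, ?_⟩
    ext ρ
    change Function.Injective (T ρ.1) ↔ _
    rw [injective_iff_map_eq_zero]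
    constructor
    · intro hi f hf
      have hk : ∀ (k : K) (v : V), f (k • v) = k • f v := by
        intro k v
        have := hf (algebraMap K A k) v
        rw [hρ] at this
        exact this
      let g : V →ₗ[K] M := { f with map_smul' := hk }
      have hg : g = 0 := hi g (by
        funext a v
        exact sub_eq_zero.mpr (hf a v))
      ext v
      exact LinearMap.congr_fun hg v
    · intro hi g hg
      have := hi g.toAddMonoidHom (fun a v => sub_eq_zero.mp (congrFun (congrFun hg a) v))
      ext v
      exact DFunLike.congr_fun this v
  · let T : (A →ₗ[K] (V →ₗ[K] V)) → (M →ₗ[K] V) →ₗ[K] (A → M → V) := fun w =>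
      { toFun := fun f a x => w a (f x) - f (a • x)
        map_add' := fun f g => by
          funext a v; simp only [LinearMap.add_apply, Pi.add_apply, map_add]; abel
        map_smul' := fun k f => by
          funext a v
          simp only [LinearMap.smul_apply, Pi.smul_apply, RingHom.id_apply, smul_sub, map_smul] }
    let L : (M →ₗ[K] V) → (A →ₗ[K] (V →ₗ[K] V)) →ₗ[K] (A → M → V) := fun f =>
      { toFun := fun w a x => w a (f x)
        map_add' := fun w w' => by funext a v; simp
        map_smul' := fun k w => by funext a v; simp }
    have h := isOpen_injective_family K _ _ _ T L (fun f a x => - f (a • x))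
      (fun w f => by funext a v; simp [T, L, sub_eq_add_neg])
    refine ⟨_, h, ?_⟩
    ext ρ
    change Function.Injective (T ρ.1) ↔ _
    rw [injective_iff_map_eq_zero]
    constructor
    · intro hi f hf
      have hk : ∀ (k : K) (x : M), f (k • x) = k • f x := by
        intro k x
        have := hf (algebraMap K A k) x
        rw [hρ] at this
        exact this
      let g : M →ₗ[K] V := { f with map_smul' := hk }
      have hg : g = 0 := hi g (by
        funext a x
        exact sub_eq_zero.mpr (hf a x).symm)
      ext x
      exact LinearMap.congr_fun hg x
    · intro hi g hg
      have := hi g.toAddMonoidHom (fun a x => (sub_eq_zero.mp (congrFun (congrFun hg a) x)).symm)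
      ext x
      exact DFunLike.congr_fun this x

end TorsPaper
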